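/- Let R be a TRS over a first-order language L, and let s, t be terms with s ↔*_R t and t ∈ NF(R). If some variable occurs in t but does not occur in s, then →_R does not have UNC. -/

import Mathlib

open FirstOrder Language

/-- `(l, r)` is a rewrite rule: `l` is not a variable and every variable
occurring in `r` also occurs in `l`. -/
def IsRule (L : Language) (p : L.Term ℕ × L.Term ℕ) : Prop :=
  (∀ v : ℕ, p.1 ≠ Term.var v) ∧ p.2.varFinset ⊆ p.1.varFinset

/-- The one-step rewrite relation of a finite set `R` of rules:
root steps are instances of rules, and rewriting is closed under
rewriting one argument of a function application. -/
inductive Rew (L : Language) (R : Finset (L.Term ℕ × L.Term ℕ)) :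
    L.Term ℕ → L.Term ℕ → Prop
  | root (l r : L.Term ℕ) (σ : ℕ → L.Term ℕ) :
      (l, r) ∈ R → Rew L R (l.subst σ) (r.subst σ)
  | congr {n : ℕ} (f : L.Functions n) (ts : Fin n → L.Term ℕ) (i : Fin n)
      (t' : L.Term ℕ) :
      Rew L R (ts i) t' →
      Rew L R (Term.func f ts) (Term.func f (Function.update ts i t'))

/-- `t` is a normal form of `→_R`. -/
def NF {L : Language} (R : Finset (L.Term ℕ × L.Term ℕ)) (t : L.Term ℕ) : Prop :=
  ∀ u, ¬ Rew L R t u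

/-- `→_R` has unique normal forms with respect to conversion. -/
def UNC {L : Language} (R : Finset (L.Term ℕ × L.Term ℕ)) : Prop :=
  ∀ s t : L.Term ℕ, Relation.EqvGen (Rew L R) s t → NF R s → NF R t → s = t

theorem FirstOrder.Language.Term.subst_subst {L : Language} {α β γ : Type*} (t : L.Term α)
    (σ : α → L.Term β) (τ : β → L.Term γ) :
    (t.subst σ).subst τ = t.subst fun a => (σ a).subst τ := by
  induction t with
  | var => rfl
  | func f ts ih => simp [Term.subst, ih]

theorem FirstOrder.Language.Term.subst_var {L : Language} {α : Type*} (t : L.Term α) :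
    t.subst Term.var = t := by
  induction t with
  | var => rfl
  | func f ts ih => simp [Term.subst, ih]

/-- A substitution fixes a term exactly when it fixes each variable occurring in it. -/
theorem FirstOrder.Language.Term.subst_eq_self_iff {L : Language} {α : Type*} [DecidableEq α]
    (t : L.Term α) (σ : α → L.Term α) :
    t.subst σ = t ↔ ∀ a ∈ t.varFinset, σ a = Term.var a := by
  induction t with
  | var => simp [Term.subst]
  | func f ts ih =>
    simp only [Term.subst, Term.func.injEq, heq_eq_eq, true_and, funext_iff, ih,
      Term.varFinset, Finset.mem_biUnion, Finset.mem_univ]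
    exact ⟨fun h a ⟨i, hi⟩ => h i a hi, fun h i a hi => h a ⟨i, hi⟩⟩

theorem Rew.subst {L : Language} {R : Finset (L.Term ℕ × L.Term ℕ)} {s t : L.Term ℕ}
    (h : Rew L R s t) (τ : ℕ → L.Term ℕ) : Rew L R (s.subst τ) (t.subst τ) := by
  induction h with
  | root l r σ hlr =>
    rw [Term.subst_subst, Term.subst_subst]
    exact Rew.root l r _ hlr
  | congr f ts i t' _ ih =>
    have key : (Term.func f (Function.update ts i t')).subst τ =
        Term.func f (Function.update (fun j => (ts j).subst τ) i (t'.subst τ)) := by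
      simp only [Term.subst]
      congr 1
      funext j
      exact Function.apply_update (fun _ u => u.subst τ) ts i t' j
    rw [key]
    exact Rew.congr f (fun j => (ts j).subst τ) i _ ih

theorem eqvGen_rew_subst {L : Language} {R : Finset (L.Term ℕ × L.Term ℕ)} {s t : L.Term ℕ}
    (h : Relation.EqvGen (Rew L R) s t) (τ : ℕ → L.Term ℕ) :
    Relation.EqvGen (Rew L R) (s.subst τ) (t.subst τ) := by
  induction h with
  | rel x y h => exact .rel _ _ (h.subst τ)
  | refl x => exact .refl _
  | symm x y _ ih => exact .symm _ _ ih
  | trans x y z _ _ ih₁ ih₂ => exact .trans _ _ _ ih₁ ih₂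

/-- Normal forms are closed under renaming of variables by a permutation. -/
theorem NF.subst_perm {L : Language} {R : Finset (L.Term ℕ × L.Term ℕ)} {t : L.Term ℕ}
    (ht : NF R t) (e : Equiv.Perm ℕ) : NF R (t.subst fun a => Term.var (e a)) := by
  intro u hu
  have h := hu.subst fun a => Term.var (e.symm a)
  simp only [Term.subst_subst, Term.subst, Equiv.symm_apply_apply] at h
  exact ht _ (t.subst_var ▸ h)

theorem not_unc_of_extra_variable {L : Language}
    (R : Finset (L.Term ℕ × L.Term ℕ)) (hR : ∀ p ∈ R, IsRule L p)
    (s t : L.Term ℕ) (hconv : Relation.EqvGen (Rew L R) s t) (ht : NF R t)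
    (hvar : ∃ v : ℕ, v ∈ t.varFinset ∧ v ∉ s.varFinset) :
    ¬ UNC R := by
  intro hunc
  obtain ⟨v, hvt, hvs⟩ := hvar
  obtain ⟨w, hw⟩ := Infinite.exists_notMem_finset (insert v s.varFinset)
  obtain ⟨hwv, hws⟩ : w ≠ v ∧ w ∉ s.varFinset := by simpa using hw
  let σ : ℕ → L.Term ℕ := fun a => Term.var (Equiv.swap v w a)
  have hs : s.subst σ = s := by
    refine (s.subst_eq_self_iff σ).2 fun a ha => congrArg Term.var ?_
    exact Equiv.swap_apply_of_ne_of_ne (ne_of_mem_of_not_mem ha hvs)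
      (ne_of_mem_of_not_mem ha hws)
  have hconv' : Relation.EqvGen (Rew L R) s (t.subst σ) :=
    hs ▸ eqvGen_rew_subst hconv σ
  have heq : t.subst σ = t :=
    hunc _ _ (.trans _ _ _ (.symm _ _ hconv') hconv) (ht.subst_perm (Equiv.swap v w)) ht
  have hfix := (t.subst_eq_self_iff σ).1 heq v hvt
  simp only [σ, Equiv.swap_apply_left, Term.var.injEq] at hfix
  exact hwv hfix
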